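/- For n ≥ 6, the wheel W_n = G⁺_{n,1,n−3} has exactly n − 1 maximal subdividable sets of edges: each one consists of all edges of the rim together with exactly one spoke. -/

import Mathlib

namespace K24Paper

open SimpleGraph

/-- `H` is a minor of `G`: branch sets indexed by vertices of `H`, pairwise disjoint,
each inducing a connected subgraph of `G`, with every edge of `H` realized by an edge
of `G` between the corresponding branch sets. -/
def IsMinor {W V : Type*} (H : SimpleGraph W) (G : SimpleGraph V) : Prop :=
  ∃ B : W → Set V,
    (∀ w, (G.induce (B w)).Connected) ∧
    (∀ w₁ w₂, w₁ ≠ w₂ → Disjoint (B w₁) (B w₂)) ∧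
    (∀ w₁ w₂, H.Adj w₁ w₂ → ∃ v₁ ∈ B w₁, ∃ v₂ ∈ B w₂, G.Adj v₁ v₂)

/-- `G` is `H`-minor-free. -/
def MinorFree {W V : Type*} (H : SimpleGraph W) (G : SimpleGraph V) : Prop :=
  ¬ IsMinor H G

/-- The complete bipartite graph `K_{2,4}`. -/
def K24 : SimpleGraph (Fin 2 ⊕ Fin 4) := completeBipartiteGraph (Fin 2) (Fin 4)

/-- `G` is `k`-connected: more than `k` vertices, and removing fewer than `k`
vertices leaves a connected graph. -/
def KConnected {V : Type*} (k : ℕ) (G : SimpleGraph V) : Prop :=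
  k < Nat.card V ∧ ∀ S : Set V, S.ncard < k → (G.induce Sᶜ).Connected

/-- The graph `G_{n,r,s}` (with the plus edge if `plus = true`), on vertices
`0, …, n-1` corresponding to `v_1, …, v_n`:  the spine `v_1 v_2 ⋯ v_n`, the edges
`v_1 v_{n-i}` for `1 ≤ i ≤ r`, the edges `v_n v_{1+j}` for `1 ≤ j ≤ s`, and
(if `plus`) the plus edge `v_1 v_n`. -/
def Gnrs (n r s : ℕ) (plus : Bool) : SimpleGraph (Fin n) :=
  SimpleGraph.fromRel (fun a b =>
    b.val = a.val + 1 ∨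
    (a.val = 0 ∧ n - 1 - r ≤ b.val ∧ b.val ≤ n - 2) ∨
    (b.val = n - 1 ∧ 1 ≤ a.val ∧ a.val ≤ s) ∨
    (plus = true ∧ a.val = 0 ∧ b.val = n - 1))

/-- The parameter conditions describing membership in the class `𝒢`. -/
def Gparams (n r s : ℕ) (plus : Bool) : Prop :=
  (plus = true ∧ 4 ≤ n ∧ ((r = 1 ∧ s = n - 3) ∨ (r = n - 3 ∧ s = 1))) ∨
  (5 ≤ n ∧ 2 ≤ r ∧ r ≤ n - 3 ∧ 2 ≤ s ∧ s ≤ n - 3 ∧ (r + s = n - 2 ∨ r + s = n - 1))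

/-- `G` belongs to `𝒢̃`, i.e. `G` is isomorphic to a graph of the class `𝒢`. -/
def InGtilde {V : Type*} (G : SimpleGraph V) : Prop :=
  ∃ n r s plus, Gparams n r s plus ∧ Nonempty (G ≃g Gnrs n r s plus)

/-- The graph obtained from `G` by subdividing every edge in `F` once:
new vertices are the members of `F`. -/
def SubdivideEdges {V : Type*} (G : SimpleGraph V) (F : Set (Sym2 V)) :
    SimpleGraph (V ⊕ F) :=
  SimpleGraph.fromRel (fun a b =>
    match a, b with
    | Sum.inl u, Sum.inl v => G.Adj u v ∧ s(u, v) ∉ F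
    | Sum.inl u, Sum.inr e => u ∈ (e : Sym2 V)
    | Sum.inr e, Sum.inl u => u ∈ (e : Sym2 V)
    | Sum.inr _, Sum.inr _ => False)

/-- A set `F` of edges of a graph `G` is subdividable if subdividing every edge
of `F` once yields a `K_{2,4}`-minor-free graph. -/
def Subdividable {V : Type*} (G : SimpleGraph V) (F : Set (Sym2 V)) : Prop :=
  F ⊆ G.edgeSet ∧ MinorFree K24 (SubdivideEdges G F)

/-- `F` is a maximal subdividable set of edges of `G`. -/
def MaxSubdividable {V : Type*} (G : SimpleGraph V) (F : Set (Sym2 V)) : Prop :=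
  Subdividable G F ∧ ∀ F', Subdividable G F' → F ⊆ F' → F' = F

/-- `l` lists vertices along a path of `G` (consecutive entries adjacent, no repeats)
such that no two edges of `G` cross with respect to this ordering. -/
def OuterListing {U : Type*} (G : SimpleGraph U) (l : List U) : Prop :=
  l.Nodup ∧ l.Chain' G.Adj ∧
  ∀ (i k j m : ℕ) (h1 : i < k) (h2 : k < j) (h3 : j < m) (hm : m < l.length),
    ¬(G.Adj (l.get ⟨i, by omega⟩) (l.get ⟨j, by omega⟩) ∧
      G.Adj (l.get ⟨k, by omega⟩) (l.get ⟨m, by omega⟩))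

/-- The graph `G` restricted to the vertex set `A` is `xy`-outerplanar: it has a
hamilton `xy`-path (listing exactly the vertices of `A`) such that no two edges
cross with respect to it. -/
def XYOuterplanar {U : Type*} (G : SimpleGraph U) (A : Set U) (x y : U) : Prop :=
  ∃ l : List U, (∀ v, v ∈ l ↔ v ∈ A) ∧ l.head? = some x ∧ l.getLast? = some y ∧
    OuterListing G l

/-- A block: a connected graph with no cutvertex. -/
def IsBlock {V : Type*} (G : SimpleGraph V) : Prop :=
  G.Connected ∧ ∀ v : V, (G.induce {u | u ≠ v}).Preconnected

/-- `G + xy`: the graph `G` with the edge `xy` added (if not already present). -/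
def AddEdge {U : Type*} (G : SimpleGraph U) (x y : U) : SimpleGraph U :=
  G ⊔ SimpleGraph.fromRel (fun a b => a = x ∧ b = y)

/-- A standard `K_{2,t}` minor `(R₁, R₂; S)` of `G`. -/
def StdK2tMinor {V : Type*} (G : SimpleGraph V) (t : ℕ) (R₁ R₂ S : Set V) : Prop :=
  Disjoint R₁ R₂ ∧ Disjoint (R₁ ∪ R₂) S ∧
  (G.induce R₁).Connected ∧ (G.induce R₂).Connected ∧
  S.Finite ∧ S.ncard = t ∧
  ∀ v ∈ S, (∃ w ∈ R₁, G.Adj v w) ∧ (∃ w ∈ R₂, G.Adj v w)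

/-- `K_{3,3}` with parts `{0,1,2}` and `{3,4,5}`. -/
def K33 : SimpleGraph (Fin 6) :=
  SimpleGraph.fromRel (fun a b => a.val < 3 ∧ 3 ≤ b.val)

/-- The graph `A = K_{3,3} + v₂v₃`. -/
def GA : SimpleGraph (Fin 6) := AddEdge K33 1 2

/-- The graph `A⁺ = K_{3,3} + v₂v₃ + v₅v₆`. -/
def GAplus : SimpleGraph (Fin 6) := AddEdge GA 4 5

/-- The graph `B`, on vertices `h, r₁, r₂, r₃, r₄, g₁, g₂ = 0, …, 6`. -/
def GB : SimpleGraph (Fin 7) :=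
  SimpleGraph.fromRel (fun a b => (a.val, b.val) ∈
    [(0,3),(0,4),(1,4),(2,3),(3,4),(5,0),(5,1),(5,2),(6,0),(6,1),(6,2)])

/-- The graph `B⁺ = B + g₁g₂`. -/
def GBplus : SimpleGraph (Fin 7) := AddEdge GB 5 6

/-- The graph `C⁺`, on vertices `v₁, …, v₈ = 0, …, 7`. -/
def GCplus : SimpleGraph (Fin 8) :=
  SimpleGraph.fromRel (fun a b => (a.val, b.val) ∈
    [(0,1),(0,2),(1,2),(3,4),(3,5),(3,6),(3,7),(4,5),(4,6),(4,7),(2,5),(1,7),(0,6)])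

/-- The graph `C = C⁺ ∖ v₄v₅`. -/
def GC : SimpleGraph (Fin 8) := GCplus.deleteEdges {s(3, 4)}

/-- The graph `D`, on vertices `t₁, t₂, t₃, d₁, d₂, d₃, g = 0, …, 6`. -/
def GD : SimpleGraph (Fin 7) :=
  SimpleGraph.fromRel (fun a b => (a.val, b.val) ∈
    [(0,1),(0,2),(1,2),(3,4),(3,5),(4,5),(0,3),(1,4),(2,5),(6,0),(6,1),(6,2)])

/-- The complete graph `K₅`. -/
def GK5 : SimpleGraph (Fin 5) := completeGraph (Fin 5)

end K24Paper

namespace K24Paper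
open SimpleGraph

/-- A function constant along edges is constant on connected induced subgraphs. -/
theorem const_of_conn {V α : Type*} {G : SimpleGraph V} {R : Set V}
    (hR : (G.induce R).Connected) (cl : V → α)
    (h : ∀ v ∈ R, ∀ w ∈ R, G.Adj v w → cl v = cl w) :
    ∀ v ∈ R, ∀ w ∈ R, cl v = cl w := by
  intro v hv w hw
  obtain ⟨p⟩ := hR.preconnected ⟨v, hv⟩ ⟨w, hw⟩
  have key : ∀ (a b : R), (G.induce R).Walk a b → cl a.1 = cl b.1 := by
    intro a b p
    induction p with
    | nil => rfl
    | cons hadj _ ih => exact (h _ (Subtype.prop _) _ (Subtype.prop _) hadj).trans ih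
  exact key _ _ p

/-- `G` minus the hub `h` is (a subgraph of) a cycle of length `N`, with positions given by
`pos`, together with a pendant vertex `x` attached at `c`. -/
structure Wheelish {V : Type*} (G : SimpleGraph V) (h x c : V) (pos : V → ℕ) (N : ℕ) : Prop where
  lt : ∀ v, v ≠ h → v ≠ x → pos v < N
  inj : ∀ v w, v ≠ h → v ≠ x → w ≠ h → w ≠ x → pos v = pos w → v = w
  adj : ∀ v w, v ≠ h → v ≠ x → w ≠ h → w ≠ x → G.Adj v w →
    pos v = pos w + 1 ∨ pos w = pos v + 1 ∨ (pos v = 0 ∧ pos w + 1 = N) ∨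
      (pos w = 0 ∧ pos v + 1 = N)
  pend : ∀ w, w ≠ h → G.Adj x w → w = c
  posx : pos x = pos c
  ch : c ≠ h
  cx : c ≠ x

theorem Wheelish.key_sorted {V : Type*} {G : SimpleGraph V} {h x c : V} {pos : V → ℕ} {N : ℕ}
    (W : Wheelish G h x c pos N) {R : Set V} (hR : (G.induce R).Connected) (hh : h ∉ R)
    (u₁ u₂ u₃ r₁ r₂ r₃ : V) (h₁ : u₁ ∉ R) (h₂ : u₂ ∉ R) (h₃ : u₃ ∉ R)
    (h1h : u₁ ≠ h) (h2h : u₂ ≠ h) (h3h : u₃ ≠ h) (h1x : u₁ ≠ x) (h2x : u₂ ≠ x) (h3x : u₃ ≠ x)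
    (hr₁ : r₁ ∈ R) (hr₂ : r₂ ∈ R) (hr₃ : r₃ ∈ R)
    (a₁ : G.Adj r₁ u₁) (a₂ : G.Adj r₂ u₂) (a₃ : G.Adj r₃ u₃)
    (l₁ : pos u₁ < pos u₂) (l₂ : pos u₂ < pos u₃) : False := by
  classical
  let cl : V → ℕ := fun v =>
    if pos v = pos u₁ ∨ pos v = pos u₂ ∨ pos v = pos u₃ then 0
    else if pos u₁ < pos v ∧ pos v < pos u₂ then 1
    else if pos u₂ < pos v ∧ pos v < pos u₃ then 2 else 3
  have hne : ∀ v ∈ R, v ≠ h := fun v hv e => hh (e ▸ hv)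
  have hnp : ∀ v ∈ R, v ≠ x → pos v ≠ pos u₁ ∧ pos v ≠ pos u₂ ∧ pos v ≠ pos u₃ := by
    intro v hv hvx
    refine ⟨fun e => h₁ ?_, fun e => h₂ ?_, fun e => h₃ ?_⟩
    · rw [← W.inj v u₁ (hne v hv) hvx h1h h1x e]; exact hv
    · rw [← W.inj v u₂ (hne v hv) hvx h2h h2x e]; exact hv
    · rw [← W.inj v u₃ (hne v hv) hvx h3h h3x e]; exact hv
  have L1 := W.lt u₁ h1h h1x
  have L3 := W.lt u₃ h3h h3x
  have hcl : ∀ v ∈ R, ∀ w ∈ R, G.Adj v w → cl v = cl w := by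
    intro v hv w hw hvw
    by_cases hvx : v = x
    · subst hvx
      have := W.pend w (hne w hw) hvw
      subst this
      simp only [cl, W.posx]
    · by_cases hwx : w = x
      · subst hwx
        have := W.pend v (hne v hv) hvw.symm
        subst this
        simp only [cl, W.posx]
      · have hv' := hnp v hv hvx
        have hw' := hnp w hw hwx
        have := W.adj v w (hne v hv) hvx (hne w hw) hwx hvw
        have := W.lt v (hne v hv) hvx
        have := W.lt w (hne w hw) hwx
        simp only [cl]
        split_ifs <;> omega
  have hconst := const_of_conn hR cl hcl
  have e12 := hconst _ hr₁ _ hr₂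
  have e13 := hconst _ hr₁ _ hr₃
  by_cases hx : r₁ = x ∨ r₂ = x ∨ r₃ = x
  · -- then `x ∈ R` has class `0`, hence every `rᵢ` is `x`
    have hz : cl r₁ = 0 := by
      rcases hx with e | e | e
      · have := W.pend u₁ h1h (e ▸ a₁)
        simp only [cl, e, W.posx, this, true_or, if_true]
      · have := W.pend u₂ h2h (e ▸ a₂)
        rw [e12]
        simp only [cl, e, W.posx, this, true_or, or_true, if_true]
      · have := W.pend u₃ h3h (e ▸ a₃)
        rw [e13]
        simp only [cl, e, W.posx, this, or_true, if_true]
    have hall : ∀ r ∈ R, cl r = 0 → r = x := by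
      intro r hr h0
      by_contra hrx
      have := hnp r hr hrx
      simp only [cl] at h0
      split_ifs at h0
      omega
    have x1 := hall _ hr₁ hz
    have x2 := hall _ hr₂ (e12 ▸ hz)
    have p1 := W.pend u₁ h1h (x1 ▸ a₁)
    have p2 := W.pend u₂ h2h (x2 ▸ a₂)
    rw [p1, p2] at l₁
    omega
  · push Not at hx
    obtain ⟨x1, x2, x3⟩ := hx
    have A1 := W.adj r₁ u₁ (hne _ hr₁) x1 h1h h1x a₁
    have A2 := W.adj r₂ u₂ (hne _ hr₂) x2 h2h h2x a₂
    have A3 := W.adj r₃ u₃ (hne _ hr₃) x3 h3h h3x a₃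
    have N1 := hnp _ hr₁ x1
    have N2 := hnp _ hr₂ x2
    have N3 := hnp _ hr₃ x3
    have B1 := W.lt r₁ (hne _ hr₁) x1
    have B2 := W.lt r₂ (hne _ hr₂) x2
    have B3 := W.lt r₃ (hne _ hr₃) x3
    simp only [cl] at e12 e13
    rw [if_neg (by omega : ¬ (pos r₁ = pos u₁ ∨ pos r₁ = pos u₂ ∨ pos r₁ = pos u₃))] at e12 e13
    rw [if_neg (by omega : ¬ (pos r₂ = pos u₁ ∨ pos r₂ = pos u₂ ∨ pos r₂ = pos u₃))] at e12
    rw [if_neg (by omega : ¬ (pos r₃ = pos u₁ ∨ pos r₃ = pos u₂ ∨ pos r₃ = pos u₃))] at e13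
    split_ifs at e12 <;> split_ifs at e13 <;> omega

theorem Wheelish.key {V : Type*} {G : SimpleGraph V} {h x c : V} {pos : V → ℕ} {N : ℕ}
    (W : Wheelish G h x c pos N) {R : Set V} (hR : (G.induce R).Connected) (hh : h ∉ R)
    (u : Fin 3 → V) (hu : Function.Injective u)
    (hx : ∀ i, u i ≠ x) (huh : ∀ i, u i ≠ h) (huR : ∀ i, u i ∉ R)
    (ha : ∀ i, ∃ r ∈ R, G.Adj r (u i)) : False := by
  choose r hr har using ha
  have S := fun i j k : Fin 3 => W.key_sorted hR hh (u i) (u j) (u k) (r i) (r j) (r k)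
    (huR i) (huR j) (huR k) (huh i) (huh j) (huh k) (hx i) (hx j) (hx k)
    (hr i) (hr j) (hr k) (har i) (har j) (har k)
  have D : ∀ i j : Fin 3, i ≠ j → pos (u i) ≠ pos (u j) := fun i j hij e =>
    hij (hu (W.inj _ _ (huh i) (hx i) (huh j) (hx j) e))
  have d01 := D 0 1 (by decide)
  have d02 := D 0 2 (by decide)
  have d12 := D 1 2 (by decide)
  have s1 := S 0 1 2
  have s2 := S 0 2 1
  have s3 := S 1 0 2
  have s4 := S 1 2 0
  have s5 := S 2 0 1
  have s6 := S 2 1 0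
  rcases lt_or_gt_of_ne d01 with h01 | h01 <;> rcases lt_or_gt_of_ne d02 with h02 | h02 <;>
    rcases lt_or_gt_of_ne d12 with h12 | h12 <;> first | omega | tauto

theorem exists_three (P : Fin 4 → Prop) (hP : ∀ i j, P i → P j → i = j) :
    ∃ g : Fin 3 → Fin 4, Function.Injective g ∧ ∀ i, ¬ P (g i) := by
  by_cases h : ∃ i, P i
  · obtain ⟨i, hi⟩ := h
    refine ⟨i.succAbove, Fin.succAbove_right_injective, fun j hj => ?_⟩
    exact Fin.succAbove_ne i j (hP _ _ hj hi)
  · push Not at h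
    exact ⟨Fin.castSucc, Fin.castSucc_injective 3, fun i => h _⟩

theorem Wheelish.minorFree {V : Type*} {G : SimpleGraph V} {h x c : V} {pos : V → ℕ} {N : ℕ}
    (W : Wheelish G h x c pos N) : MinorFree K24 G := by
  rintro ⟨B, hconn, hdisj, hadj⟩
  have hd : ∀ w₁ w₂ v, v ∈ B w₁ → v ∈ B w₂ → w₁ = w₂ := by
    intro w₁ w₂ v h1 h2
    by_contra hne
    exact Set.disjoint_left.1 (hdisj _ _ hne) h1 h2
  have hA : ∀ (i : Fin 2) (j : Fin 4), ∃ r ∈ B (Sum.inl i), ∃ s ∈ B (Sum.inr j), G.Adj r s := by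
    intro i j
    exact hadj _ _ (by simp [K24])
  choose r hr s hs hrs using hA
  -- general use of the key lemma
  have use_key : ∀ (i : Fin 2) (g : Fin 3 → Fin 4), Function.Injective g → h ∉ B (Sum.inl i) →
      (∀ k, h ∉ B (Sum.inr (g k))) → (∀ k, s i (g k) ≠ x) → False := by
    intro i g hg hi hk hsx
    refine W.key (hconn (Sum.inl i)) hi (fun k => s i (g k)) ?_ hsx ?_ ?_ ?_
    · intro a b hab
      have := hd _ _ _ (hs i (g a)) (show s i (g a) ∈ _ from (show s i (g a) = s i (g b) from hab) ▸ hs i (g b))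
      exact hg (Sum.inr_injective this)
    · intro k e
      exact hk k (e ▸ hs i (g k))
    · intro k hk'
      exact absurd (hd _ _ _ hk' (hs i (g k))) (by simp)
    · intro k
      exact ⟨_, hr i (g k), hrs i (g k)⟩
  by_cases hh : ∃ i : Fin 2, h ∈ B (Sum.inl i)
  · obtain ⟨i, hi⟩ := hh
    obtain ⟨j, hij⟩ : ∃ j : Fin 2, j ≠ i := exists_ne i
    obtain ⟨g, hg, hgx⟩ := exists_three (fun k => x ∈ B (Sum.inr k))
      (fun a b ha hb => Sum.inr_injective (hd _ _ _ ha hb))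
    refine use_key j g hg ?_ ?_ ?_
    · intro hj
      exact hij (Sum.inl_injective (hd _ _ _ hj hi))
    · intro k hk
      exact absurd (hd _ _ _ hk hi) (by simp)
    · intro k e
      exact hgx k (e ▸ hs j (g k))
  · push Not at hh
    obtain ⟨g, hg, hgh⟩ := exists_three (fun k => h ∈ B (Sum.inr k))
      (fun a b ha hb => Sum.inr_injective (hd _ _ _ ha hb))
    have hc : ∀ i : Fin 2, ∀ k, s i k = x → c ∈ B (Sum.inl i) := by
      intro i k e
      have h1 : r i k ≠ h := fun e' => hh i (e' ▸ hr i k)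
      have := W.pend (r i k) h1 (e ▸ (hrs i k).symm)
      exact this ▸ hr i k
    have : ∀ i : Fin 2, c ∈ B (Sum.inl i) := by
      intro i
      by_contra hci
      exact use_key i g hg (hh i) hgh (fun k e => hci (hc i _ e))
    exact absurd (hd _ _ _ (this 0) (this 1)) (by simp)

end K24Paper
namespace K24Paper
open SimpleGraph

theorem wheel_adj {n : ℕ} (hn : 6 ≤ n) (a b : Fin n) :
    (Gnrs n 1 (n - 3) true).Adj a b ↔ a.val ≠ b.val ∧
      (a.val = n - 1 ∨ b.val = n - 1 ∨ b.val = a.val + 1 ∨ a.val = b.val + 1 ∨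
        (a.val = 0 ∧ b.val = n - 2) ∨ (b.val = 0 ∧ a.val = n - 2)) := by
  have := a.2
  have := b.2
  simp only [Gnrs, SimpleGraph.fromRel_adj, ne_eq, Fin.ext_iff, true_and]
  omega

section sub
variable {V : Type*} {G : SimpleGraph V} {F : Set (Sym2 V)}

theorem sub_adj_ll (u v : V) :
    (SubdivideEdges G F).Adj (Sum.inl u) (Sum.inl v) ↔ G.Adj u v ∧ s(u, v) ∉ F := by
  simp only [SubdivideEdges, SimpleGraph.fromRel_adj]
  constructor
  · rintro ⟨-, h | h⟩
    · exact h
    · exact ⟨h.1.symm, Sym2.eq_swap (a := u) ▸ h.2⟩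
  · intro h
    exact ⟨fun e => h.1.ne (Sum.inl_injective e), Or.inl h⟩

theorem sub_adj_lr (u : V) (e : F) :
    (SubdivideEdges G F).Adj (Sum.inl u) (Sum.inr e) ↔ u ∈ (e : Sym2 V) := by
  simp [SubdivideEdges, SimpleGraph.fromRel_adj]

theorem sub_adj_rr (e f : F) :
    ¬ (SubdivideEdges G F).Adj (Sum.inr e) (Sum.inr f) := by
  simp [SubdivideEdges, SimpleGraph.fromRel_adj]

/-- The vertex `u` together with the vertex subdividing `uv`, if there is one. -/
def half (F : Set (Sym2 V)) (u v : V) : Set (V ⊕ F) :=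
  {z | z = Sum.inl u ∨ ∃ e : F, z = Sum.inr e ∧ (e : Sym2 V) = s(u, v)}

theorem half_conn (u v : V) : ((SubdivideEdges G F).induce (half F u v)).Connected := by
  by_cases h : s(u, v) ∈ F
  · have : half F u v = {Sum.inl u, Sum.inr ⟨s(u, v), h⟩} := by
      ext z
      simp only [half, Set.mem_ofPred_eq, Set.mem_insert_iff, Set.mem_singleton_iff]
      constructor
      · rintro (h | ⟨e, rfl, he⟩)
        · exact Or.inl h
        · right; congr 1; exact Subtype.ext he
      · rintro (h | h)
        · exact Or.inl h
        · exact Or.inr ⟨_, h, rfl⟩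
    rw [this]
    exact induce_pair_connected_of_adj ((sub_adj_lr _ _).2 (by simp))
  · have : half F u v = {Sum.inl u} := by
      ext z
      simp only [half, Set.mem_ofPred_eq, Set.mem_singleton_iff]
      constructor
      · rintro (h | ⟨e, rfl, he⟩)
        · exact h
        · exact absurd (he ▸ e.2) h
      · exact Or.inl
    rw [this]
    exact SimpleGraph.Connected.mk (SimpleGraph.Preconnected.of_subsingleton)

theorem half_adj {u v : V} (huv : G.Adj u v) :
    ∃ z ∈ half F u v, (SubdivideEdges G F).Adj z (Sum.inl v) := by
  by_cases h : s(u, v) ∈ F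
  · exact ⟨Sum.inr ⟨_, h⟩, Or.inr ⟨_, rfl, rfl⟩, ((sub_adj_lr _ _).2 (by simp)).symm⟩
  · exact ⟨Sum.inl u, Or.inl rfl, (sub_adj_ll _ _).2 ⟨huv, h⟩⟩

/-- The subdivided path `f 0, …, f k`. -/
def arc (F : Set (Sym2 V)) (f : ℕ → V) : ℕ → Set (V ⊕ F)
  | 0 => {Sum.inl (f 0)}
  | k + 1 => arc F f k ∪ (half F (f k) (f (k + 1)) ∪ {Sum.inl (f (k + 1))})

theorem mem_arc (f : ℕ → V) (k : ℕ) : ∀ i ≤ k, Sum.inl (f i) ∈ arc F f k := by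
  induction k with
  | zero => intro i hi; obtain rfl : i = 0 := by omega
            exact rfl
  | succ k ih =>
    intro i hi
    rcases Nat.lt_or_ge k i with h | h
    · obtain rfl : i = k + 1 := by omega
      exact Or.inr (Or.inr rfl)
    · exact Or.inl (ih i h)

theorem of_mem_arc (f : ℕ → V) (k : ℕ) : ∀ z ∈ arc F f k,
    (∃ i ≤ k, z = Sum.inl (f i)) ∨
      ∃ i < k, ∃ e : F, z = Sum.inr e ∧ (e : Sym2 V) = s(f i, f (i + 1)) := by
  induction k with
  | zero => intro z hz; exact Or.inl ⟨0, le_rfl, hz⟩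
  | succ k ih =>
    rintro z (hz | (hz | ⟨e, hz, he⟩) | hz)
    · rcases ih z hz with ⟨i, hi, h⟩ | ⟨i, hi, h⟩
      · exact Or.inl ⟨i, by omega, h⟩
      · exact Or.inr ⟨i, by omega, h⟩
    · exact Or.inl ⟨k, by omega, hz⟩
    · exact Or.inr ⟨k, by omega, e, hz, he⟩
    · exact Or.inl ⟨k + 1, le_rfl, hz⟩

theorem conn_union {W : Type*} {H : SimpleGraph W} {A B : Set W} (hA : (H.induce A).Connected)
    (hB : (H.induce B).Connected) {z : W} (hz : z ∈ A) (hz' : z ∈ B) :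
    (H.induce (A ∪ B)).Connected := by
  exact induce_union_connected hA.preconnected hB.preconnected ⟨z, hz, hz'⟩

theorem conn_single {W : Type*} (H : SimpleGraph W) (z : W) : (H.induce {z}).Connected :=
  SimpleGraph.Connected.mk (SimpleGraph.Preconnected.of_subsingleton)

theorem conn_insert {W : Type*} {H : SimpleGraph W} {A : Set W} (hA : (H.induce A).Connected)
    {z b : W} (hz : z ∈ A) (hb : H.Adj z b) : (H.induce (A ∪ {b})).Connected := by
  have h := conn_union hA (induce_pair_connected_of_adj hb) hz (by simp)
  have e : A ∪ {b} = A ∪ {z, b} := by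
    ext w
    simp only [Set.mem_union, Set.mem_singleton_iff, Set.mem_insert_iff]
    constructor
    · tauto
    · rintro (h | rfl | h)
      · exact Or.inl h
      · exact Or.inl hz
      · exact Or.inr h
  rw [e]; exact h

theorem arc_conn (f : ℕ → V) (hf : ∀ i, G.Adj (f i) (f (i + 1))) (k : ℕ) :
    ((SubdivideEdges G F).induce (arc F f k)).Connected := by
  induction k with
  | zero => exact conn_single _ _
  | succ k ih =>
    obtain ⟨z, hz, hadj⟩ := half_adj (F := F) (hf k)
    exact conn_union ih (conn_insert (half_conn _ _) hz hadj)
      (mem_arc f k k le_rfl) (Or.inl (Or.inl rfl))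

end sub

theorem minor_of {V : Type*} {H : SimpleGraph V} (R : Fin 2 → Set V) (S : Fin 4 → Set V)
    (hR : ∀ i, (H.induce (R i)).Connected) (hS : ∀ i, (H.induce (S i)).Connected)
    (dR : Disjoint (R 0) (R 1)) (dRS : ∀ i j, Disjoint (R i) (S j))
    (dS : ∀ i j, i < j → Disjoint (S i) (S j))
    (ha : ∀ i j, ∃ s ∈ S j, ∃ r ∈ R i, H.Adj s r) : IsMinor K24 H := by
  refine ⟨Sum.elim R S, ?_, ?_, ?_⟩
  · rintro (i | i)
    · exact hR i
    · exact hS i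
  · rintro (i | i) (j | j) hij
    · fin_cases i <;> fin_cases j
      · exact absurd rfl hij
      · exact dR
      · exact dR.symm
      · exact absurd rfl hij
    · exact dRS i j
    · exact (dRS j i).symm
    · rcases lt_trichotomy i j with h | h | h
      · exact dS i j h
      · exact absurd (congrArg _ h) hij
      · exact (dS j i h).symm
  · rintro (i | i) (j | j) hij
    · simp [K24] at hij
    · obtain ⟨s, hs, r, hr, h⟩ := ha i j
      exact ⟨r, hr, s, hs, h.symm⟩
    · obtain ⟨s, hs, r, hr, h⟩ := ha j i
      exact ⟨s, hs, r, hr, h⟩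
    · simp [K24] at hij

/-- The `i`-th rim vertex, cyclically. -/
def rimv (n : ℕ) (hn : 6 ≤ n) (i : ℕ) : Fin n :=
  ⟨i % (n - 1), lt_of_lt_of_le (Nat.mod_lt _ (by omega)) (by omega)⟩

theorem mod_succ_cases (m : ℕ) (hm : 2 ≤ m) (i : ℕ) :
    ((i + 1) % m = i % m + 1) ∨ (i % m = m - 1 ∧ (i + 1) % m = 0) := by
  have h := Nat.mod_lt i (show 0 < m by omega)
  rw [Nat.add_mod i 1, Nat.mod_eq_of_lt (show 1 < m by omega)]
  rcases Nat.lt_or_ge (i % m + 1) m with h1 | h1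
  · left; exact Nat.mod_eq_of_lt h1
  · right
    have : i % m + 1 = m := by omega
    exact ⟨by omega, by rw [this, Nat.mod_self]⟩

theorem mod_inj (m a i j : ℕ) (hi : i < m) (hj : j < m) (h : (a + i) % m = (a + j) % m) :
    i = j := by
  have : i ≡ j [MOD m] := Nat.ModEq.add_left_cancel' a h
  exact Nat.ModEq.eq_of_lt_of_lt this hi hj

theorem two_spokes (n : ℕ) (hn : 6 ≤ n) (F : Set (Sym2 (Fin n))) (hub : Fin n)
    (hhub : hub.val = n - 1) (a k : ℕ) (hk : 1 ≤ k) (hk' : k + 2 < n - 1)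
    (h1 : s(rimv n hn a, hub) ∈ F) (h2 : s(rimv n hn (a + k), hub) ∈ F) :
    IsMinor K24 (SubdivideEdges (Gnrs n 1 (n - 3) true) F) := by
  set G := Gnrs n 1 (n - 3) true with hG
  set f : ℕ → Fin n := fun i => rimv n hn (a + i) with hfdef
  have hfv : ∀ i, (f i).val = (a + i) % (n - 1) := fun i => rfl
  have hflt : ∀ i, (f i).val < n - 1 := fun i => Nat.mod_lt _ (by omega)
  have hfh : ∀ i, f i ≠ hub := fun i e => by
    have := hflt i; rw [e, hhub] at this; omega
  have hf : ∀ i, G.Adj (f i) (f (i + 1)) := by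
    intro i
    rw [hG, wheel_adj hn]
    have := mod_succ_cases (n - 1) (by omega) (a + i)
    simp only [hfv, ← Nat.add_assoc]
    have := Nat.mod_lt (a + i) (show 0 < n - 1 by omega)
    omega
  have hfhub : ∀ i, G.Adj (f i) hub := by
    intro i
    rw [hG, wheel_adj hn]
    have := hflt i
    omega
  have finj : ∀ i j, i < n - 1 → j < n - 1 → f i = f j → i = j := by
    intro i j hi hj e
    exact mod_inj (n - 1) a i j hi hj (congrArg Fin.val e)
  have hper : f (n - 1) = f 0 := by
    apply Fin.ext
    simp [hfv]
  have einj : ∀ i j, i < n - 1 → j < n - 1 → s(f i, f (i + 1)) = s(f j, f (j + 1)) → i = j := by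
    have nxt : ∀ i, i < n - 1 → (i + 1 < n - 1 ∧ True) ∨ (i = n - 2 ∧ f (i + 1) = f 0) := by
      intro i hi
      rcases Nat.lt_or_ge (i + 1) (n - 1) with h | h
      · exact Or.inl ⟨h, trivial⟩
      · have : i + 1 = n - 1 := by omega
        exact Or.inr ⟨by omega, by rw [this, hper]⟩
    intro i j hi hj e
    rcases Sym2.eq_iff.1 e with ⟨e1, -⟩ | ⟨e1, e2⟩
    · exact finj _ _ hi hj e1
    · exfalso
      rcases nxt i hi with ⟨hi', -⟩ | ⟨hi', hi2⟩ <;> rcases nxt j hj with ⟨hj', -⟩ | ⟨hj', hj2⟩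
      · have := finj _ _ hi hj' e1
        have := finj _ _ hi' hj e2
        omega
      · rw [hj2] at e1
        have := finj _ _ hi (by omega) e1
        have := finj _ _ hi' hj e2
        omega
      · rw [hi2] at e2
        have := finj _ _ hi hj' e1
        have := finj _ _ (by omega) hj e2
        omega
      · rw [hi2] at e2
        rw [hj2] at e1
        have := finj _ _ hi (by omega) e1
        omega
  have sinj : ∀ i j, i < n - 1 → j < n - 1 → s(f i, hub) = s(f j, hub) → i = j := by
    intro i j hi hj e
    rcases Sym2.eq_iff.1 e with ⟨e1, -⟩ | ⟨e1, -⟩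
    · exact finj _ _ hi hj e1
    · exact absurd e1 (hfh i)
  have esne : ∀ i j, s(f i, f (i + 1)) ≠ s(f j, hub) := by
    intro i j e
    rcases Sym2.eq_iff.1 e with ⟨-, e1⟩ | ⟨e1, -⟩
    · exact hfh _ e1
    · exact hfh _ e1
  -- the index-described sets
  let piece : (ℕ → Prop) → (ℕ → Prop) → (ℕ → Prop) → Set (Fin n ⊕ F) := fun P Q T =>
    {z | (∃ i, i < n - 1 ∧ P i ∧ z = Sum.inl (f i)) ∨
      (∃ i, i < n - 1 ∧ Q i ∧ ∃ e : F, z = Sum.inr e ∧ (e : Sym2 _) = s(f i, f (i + 1))) ∨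
      (∃ i, i < n - 1 ∧ T i ∧ ∃ e : F, z = Sum.inr e ∧ (e : Sym2 _) = s(f i, hub))}
  have pdisj : ∀ (P Q T P' Q' T' : ℕ → Prop) (A A' : Set (Fin n ⊕ F)),
      A ⊆ piece P Q T → A' ⊆ piece P' Q' T' →
      (∀ i, P i → ¬ P' i) → (∀ i, Q i → ¬ Q' i) → (∀ i, T i → ¬ T' i) → Disjoint A A' := by
    intro P Q T P' Q' T' A A' hA hA' hP hQ hT
    rw [Set.disjoint_left]
    intro z hz hz'
    rcases hA hz with ⟨i, hi, hPi, rfl⟩ | ⟨i, hi, hPi, e, rfl, he⟩ | ⟨i, hi, hPi, e, rfl, he⟩ <;>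
    rcases hA' hz' with ⟨j, hj, hPj, e1⟩ | ⟨j, hj, hPj, e', e1, he'⟩ | ⟨j, hj, hPj, e', e1, he'⟩
    · obtain rfl := finj _ _ hi hj (Sum.inl_injective e1)
      exact hP _ hPi hPj
    · simp at e1
    · simp at e1
    · simp at e1
    · obtain rfl := Sum.inr_injective e1
      obtain rfl := einj _ _ hi hj (he.symm.trans he')
      exact hQ _ hPi hPj
    · obtain rfl := Sum.inr_injective e1
      exact esne _ _ (he.symm.trans he')
    · simp at e1
    · obtain rfl := Sum.inr_injective e1
      exact esne _ _ (he'.symm.trans he)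
    · obtain rfl := Sum.inr_injective e1
      obtain rfl := sinj _ _ hi hj (he.symm.trans he')
      exact hT _ hPi hPj
  -- the branch sets
  let R1 : Set (Fin n ⊕ F) := {Sum.inl hub}
  let R2 : Set (Fin n ⊕ F) := arc F f k
  let Sx : Set (Fin n ⊕ F) := {Sum.inr ⟨s(f 0, hub), h1⟩}
  let Sy : Set (Fin n ⊕ F) := {Sum.inr ⟨s(f k, hub), h2⟩}
  let Sp : Set (Fin n ⊕ F) := half F (f (k + 1)) hub ∪ half F (f (k + 1)) (f k)
  let Sq : Set (Fin n ⊕ F) := half F (f (n - 2)) hub ∪ half F (f (n - 2)) (f (n - 2 + 1))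
  have hlast : f (n - 2 + 1) = f 0 := by
    rw [show n - 2 + 1 = n - 1 by omega, hper]
  have cR2 : R2 ⊆ piece (fun i => i ≤ k) (fun i => i < k) (fun _ => False) := by
    intro z hz
    rcases of_mem_arc f k z hz with ⟨i, hi, h⟩ | ⟨i, hi, h⟩
    · exact Or.inl ⟨i, by omega, hi, h⟩
    · exact Or.inr (Or.inl ⟨i, by omega, hi, h⟩)
  have cSx : Sx ⊆ piece (fun _ => False) (fun _ => False) (fun i => i = 0) := by
    rintro z hz
    exact Or.inr (Or.inr ⟨0, by omega, rfl, _, hz, rfl⟩)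
  have cSy : Sy ⊆ piece (fun _ => False) (fun _ => False) (fun i => i = k) := by
    rintro z hz
    exact Or.inr (Or.inr ⟨k, by omega, rfl, _, hz, rfl⟩)
  have cSp : Sp ⊆ piece (fun i => i = k + 1) (fun i => i = k) (fun i => i = k + 1) := by
    rintro z ((hz | ⟨e, hz, he⟩) | (hz | ⟨e, hz, he⟩))
    · exact Or.inl ⟨k + 1, by omega, rfl, hz⟩
    · exact Or.inr (Or.inr ⟨k + 1, by omega, rfl, e, hz, he⟩)
    · exact Or.inl ⟨k + 1, by omega, rfl, hz⟩
    · exact Or.inr (Or.inl ⟨k, by omega, rfl, e, hz, he.trans Sym2.eq_swap⟩)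
  have cSq : Sq ⊆ piece (fun i => i = n - 2) (fun i => i = n - 2) (fun i => i = n - 2) := by
    rintro z ((hz | ⟨e, hz, he⟩) | (hz | ⟨e, hz, he⟩))
    · exact Or.inl ⟨n - 2, by omega, rfl, hz⟩
    · exact Or.inr (Or.inr ⟨n - 2, by omega, rfl, e, hz, he⟩)
    · exact Or.inl ⟨n - 2, by omega, rfl, hz⟩
    · exact Or.inr (Or.inl ⟨n - 2, by omega, rfl, e, hz, he⟩)
  have dhub : ∀ (P Q T : ℕ → Prop) (A : Set (Fin n ⊕ F)), A ⊆ piece P Q T → Disjoint R1 A := by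
    intro P Q T A hA
    rw [Set.disjoint_left]
    rintro z hz hz'
    obtain rfl : z = Sum.inl hub := hz
    rcases hA hz' with ⟨i, -, -, e⟩ | ⟨i, -, -, e, e1, -⟩ | ⟨i, -, -, e, e1, -⟩
    · exact hfh i (Sum.inl_injective e).symm
    · simp at e1
    · simp at e1
  have single : ∀ z : Fin n ⊕ F, ((SubdivideEdges G F).induce {z}).Connected := fun z =>
    SimpleGraph.Connected.mk (SimpleGraph.Preconnected.of_subsingleton)
  have cunion : ∀ u v w : Fin n,
      ((SubdivideEdges G F).induce (half F u v ∪ half F u w)).Connected := fun u v w =>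
    conn_union (half_conn u v) (half_conn u w)
      (z := Sum.inl u) (Or.inl rfl) (Or.inl rfl)
  refine minor_of ![R1, R2] ![Sx, Sy, Sp, Sq] ?_ ?_ ?_ ?_ ?_ ?_
  · intro i
    fin_cases i
    · exact single _
    · exact arc_conn f hf k
  · intro i
    fin_cases i
    · exact single _
    · exact single _
    · exact cunion _ _ _
    · exact cunion _ _ _
  · exact dhub _ _ _ _ cR2
  · intro i j
    fin_cases i
    · fin_cases j
      · exact dhub _ _ _ _ cSx
      · exact dhub _ _ _ _ cSy
      · exact dhub _ _ _ _ cSp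
      · exact dhub _ _ _ _ cSq
    · fin_cases j
      · exact pdisj _ _ _ _ _ _ _ _ cR2 cSx
          (by first | omega | exact fun _ h _ => h | exact fun _ _ h => h)
          (by first | omega | exact fun _ h _ => h | exact fun _ _ h => h)
          (by first | omega | exact fun _ h _ => h | exact fun _ _ h => h)
      · exact pdisj _ _ _ _ _ _ _ _ cR2 cSy
          (by first | omega | exact fun _ h _ => h | exact fun _ _ h => h)
          (by first | omega | exact fun _ h _ => h | exact fun _ _ h => h)
          (by first | omega | exact fun _ h _ => h | exact fun _ _ h => h)
      · exact pdisj _ _ _ _ _ _ _ _ cR2 cSp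
          (by first | omega | exact fun _ h _ => h | exact fun _ _ h => h)
          (by first | omega | exact fun _ h _ => h | exact fun _ _ h => h)
          (by first | omega | exact fun _ h _ => h | exact fun _ _ h => h)
      · exact pdisj _ _ _ _ _ _ _ _ cR2 cSq
          (by first | omega | exact fun _ h _ => h | exact fun _ _ h => h)
          (by first | omega | exact fun _ h _ => h | exact fun _ _ h => h)
          (by first | omega | exact fun _ h _ => h | exact fun _ _ h => h)
  · intro i j hij
    fin_cases i <;> fin_cases j <;> first | (exfalso; revert hij; decide) | skip
    · exact pdisj _ _ _ _ _ _ _ _ cSx cSy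
          (by first | omega | exact fun _ h _ => h | exact fun _ _ h => h)
          (by first | omega | exact fun _ h _ => h | exact fun _ _ h => h)
          (by first | omega | exact fun _ h _ => h | exact fun _ _ h => h)
    · exact pdisj _ _ _ _ _ _ _ _ cSx cSp
          (by first | omega | exact fun _ h _ => h | exact fun _ _ h => h)
          (by first | omega | exact fun _ h _ => h | exact fun _ _ h => h)
          (by first | omega | exact fun _ h _ => h | exact fun _ _ h => h)
    · exact pdisj _ _ _ _ _ _ _ _ cSx cSq
          (by first | omega | exact fun _ h _ => h | exact fun _ _ h => h)
          (by first | omega | exact fun _ h _ => h | exact fun _ _ h => h)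
          (by first | omega | exact fun _ h _ => h | exact fun _ _ h => h)
    · exact pdisj _ _ _ _ _ _ _ _ cSy cSp
          (by first | omega | exact fun _ h _ => h | exact fun _ _ h => h)
          (by first | omega | exact fun _ h _ => h | exact fun _ _ h => h)
          (by first | omega | exact fun _ h _ => h | exact fun _ _ h => h)
    · exact pdisj _ _ _ _ _ _ _ _ cSy cSq
          (by first | omega | exact fun _ h _ => h | exact fun _ _ h => h)
          (by first | omega | exact fun _ h _ => h | exact fun _ _ h => h)
          (by first | omega | exact fun _ h _ => h | exact fun _ _ h => h)
    · exact pdisj _ _ _ _ _ _ _ _ cSp cSq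
          (by first | omega | exact fun _ h _ => h | exact fun _ _ h => h)
          (by first | omega | exact fun _ h _ => h | exact fun _ _ h => h)
          (by first | omega | exact fun _ h _ => h | exact fun _ _ h => h)
  · have hs0 : ∀ u v (h : s(u, v) ∈ F),
        (SubdivideEdges G F).Adj (Sum.inr ⟨s(u, v), h⟩) (Sum.inl u) := fun u v h =>
      ((sub_adj_lr _ _).2 (by simp)).symm
    have hs1 : ∀ u v (h : s(u, v) ∈ F),
        (SubdivideEdges G F).Adj (Sum.inr ⟨s(u, v), h⟩) (Sum.inl v) := fun u v h =>
      ((sub_adj_lr _ _).2 (by simp)).symm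
    intro i j
    fin_cases i
    · fin_cases j
      · exact ⟨_, rfl, _, rfl, hs1 _ _ _⟩
      · exact ⟨_, rfl, _, rfl, hs1 _ _ _⟩
      · obtain ⟨z, hz, ha⟩ := half_adj (F := F) (hfhub (k + 1))
        exact ⟨z, Or.inl hz, _, rfl, ha⟩
      · obtain ⟨z, hz, ha⟩ := half_adj (F := F) (hfhub (n - 2))
        exact ⟨z, Or.inl hz, _, rfl, ha⟩
    · fin_cases j
      · exact ⟨_, rfl, _, mem_arc f k 0 (by omega), hs0 _ _ _⟩
      · exact ⟨_, rfl, _, mem_arc f k k (by omega), hs0 _ _ _⟩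
      · obtain ⟨z, hz, ha⟩ := half_adj (F := F) (hf k).symm
        exact ⟨z, Or.inr hz, _, mem_arc f k k (by omega), ha⟩
      · obtain ⟨z, hz, ha⟩ := half_adj (F := F) (hf (n - 2))
        exact ⟨z, Or.inr hz, _, hlast ▸ mem_arc f k 0 (by omega), ha⟩

/-- A subdividable set has at most one spoke. -/
theorem spoke_unique (n : ℕ) (hn : 6 ≤ n) (F : Set (Sym2 (Fin n))) (hub : Fin n)
    (hhub : hub.val = n - 1) (hF : Subdividable (Gnrs n 1 (n - 3) true) F)
    (e e' : Sym2 (Fin n)) (he : e ∈ F) (he' : e' ∈ F) (hh : hub ∈ e) (hh' : hub ∈ e') :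
    e = e' := by
  have main : ∀ u v : Fin n, u.val < n - 1 → v.val < n - 1 → s(u, hub) ∈ F → s(v, hub) ∈ F →
      u.val < v.val → False := by
    intro u v hu hv h1 h2 huv
    apply hF.2
    have ru : rimv n hn u.val = u := Fin.ext (Nat.mod_eq_of_lt hu)
    have rv : rimv n hn v.val = v := Fin.ext (Nat.mod_eq_of_lt hv)
    rcases Nat.lt_or_ge (v.val - u.val + 2) (n - 1) with h | h
    · refine two_spokes n hn F hub hhub u.val (v.val - u.val) (by omega) h ?_ ?_
      · rw [ru]; exact h1
      · rw [show u.val + (v.val - u.val) = v.val by omega, rv]; exact h2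
    · refine two_spokes n hn F hub hhub v.val (n - 1 - (v.val - u.val)) (by omega) (by omega) ?_ ?_
      · rw [rv]; exact h2
      · have : rimv n hn (v.val + (n - 1 - (v.val - u.val))) = u := by
          apply Fin.ext
          show (v.val + (n - 1 - (v.val - u.val))) % (n - 1) = u.val
          rw [show v.val + (n - 1 - (v.val - u.val)) = u.val + (n - 1) by omega,
            Nat.add_mod_right]
          exact Nat.mod_eq_of_lt hu
        rw [this]; exact h1
  obtain ⟨u, rfl⟩ := hh
  obtain ⟨v, rfl⟩ := hh'
  have au := (wheel_adj hn _ _).1 ((SimpleGraph.mem_edgeSet _).1 (hF.1 he))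
  have av := (wheel_adj hn _ _).1 ((SimpleGraph.mem_edgeSet _).1 (hF.1 he'))
  have := u.2
  have := v.2
  rw [Sym2.eq_swap] at he he'
  rcases lt_trichotomy u.val v.val with h | h | h
  · exact (main u v (by omega) (by omega) he he' h).elim
  · rw [Fin.ext h]
  · exact (main v u (by omega) (by omega) he' he h).elim

end K24Paper
namespace K24Paper
open SimpleGraph

/-- Sum of the labels of the endpoints of an edge. -/
def esum {n : ℕ} : Sym2 (Fin n) → ℕ :=
  Sym2.lift ⟨fun a b => a.val + b.val, fun _ _ => Nat.add_comm _ _⟩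

theorem esum_mk {n : ℕ} (a b : Fin n) : esum s(a, b) = a.val + b.val := rfl

/-- Rim edges, in normal form. -/
theorem rim_cases {n : ℕ} (hn : 6 ≤ n) (hub : Fin n) (hhub : hub.val = n - 1)
    (e : Sym2 (Fin n)) (he : e ∈ (Gnrs n 1 (n - 3) true).edgeSet) (hh : hub ∉ e) :
    ∃ a b : Fin n, e = s(a, b) ∧ b.val < n - 1 ∧
      (b.val = a.val + 1 ∨ (a.val = 0 ∧ b.val = n - 2)) := by
  induction e using Sym2.inductionOn with
  | _ a b =>
    have h := (wheel_adj hn a b).1 he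
    have ha : a.val ≠ n - 1 := fun e' => hh (by
      rw [show hub = a from Fin.ext (by omega)]; simp)
    have hb : b.val ≠ n - 1 := fun e' => hh (by
      rw [show hub = b from Fin.ext (by omega)]; simp)
    have := a.2
    have := b.2
    by_cases hc : b.val = a.val + 1 ∨ (a.val = 0 ∧ b.val = n - 2)
    · exact ⟨a, b, rfl, by omega, hc⟩
    · exact ⟨b, a, Sym2.eq_swap, by omega, by omega⟩

theorem rim_spoke_subdividable (n : ℕ) (hn : 6 ≤ n) (hub : Fin n) (hhub : hub.val = n - 1)
    (e : Sym2 (Fin n)) (he : e ∈ (Gnrs n 1 (n - 3) true).edgeSet) (hh : hub ∈ e) :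
    Subdividable (Gnrs n 1 (n - 3) true)
      ({e' ∈ (Gnrs n 1 (n - 3) true).edgeSet | hub ∉ e'} ∪ {e}) := by
  classical
  refine ⟨?_, ?_⟩
  · rintro e' (h | h)
    · exact h.1
    · rw [show e' = e from h]; exact he
  obtain ⟨c, rfl⟩ := hh
  have hc := (wheel_adj hn hub c).1 he
  set F : Set (Sym2 (Fin n)) :=
    {e' ∈ (Gnrs n 1 (n - 3) true).edgeSet | hub ∉ e'} ∪ {s(hub, c)} with hF
  have hxF : s(hub, c) ∈ F := Or.inr rfl
  have hcn := c.2
  let epos : Sym2 (Fin n) → ℕ := fun e =>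
    if e = s(hub, c) then 2 * c.val else if esum e = n - 2 ∧ (⟨0, by omega⟩ : Fin n) ∈ e
      then 2 * n - 3 else esum e
  let pos : Fin n ⊕ F → ℕ := Sum.elim (fun i => 2 * i.val) (fun e => epos e.1)
  have hl : ∀ i : Fin n, pos (Sum.inl i) = 2 * i.val := fun i => rfl
  have hr : ∀ e : F, e ≠ ⟨s(hub, c), hxF⟩ → ∃ a b : Fin n, e.1 = s(a, b) ∧ b.val < n - 1 ∧
      ((b.val = a.val + 1 ∧ pos (Sum.inr e) = 2 * a.val + 1) ∨
        (a.val = 0 ∧ b.val = n - 2 ∧ pos (Sum.inr e) = 2 * n - 3)) := by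
    rintro ⟨e, he'⟩ hne
    have hne' : e ≠ s(hub, c) := fun h => hne (Subtype.ext h)
    rcases he' with h | h
    swap
    · exact absurd h hne'
    obtain ⟨a, b, rfl, hb, hab⟩ := rim_cases hn hub hhub e h.1 h.2
    refine ⟨a, b, rfl, hb, ?_⟩
    show _ ∨ (_ ∧ _ ∧ epos s(a, b) = _)
    have hz : (⟨0, by omega⟩ : Fin n) ∈ s(a, b) ↔ (a.val = 0 ∨ b.val = 0) := by
      simp only [Sym2.mem_iff, Fin.ext_iff, eq_comm]
    rcases hab with hab | hab
    · left
      refine ⟨hab, ?_⟩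
      show epos s(a, b) = _
      simp only [epos, if_neg hne']
      rw [if_neg (by rw [hz, esum_mk]; omega), esum_mk]
      omega
    · right
      refine ⟨hab.1, hab.2, ?_⟩
      simp only [epos, if_neg hne']
      rw [if_pos (by rw [hz, esum_mk]; omega)]
  have W : Wheelish (SubdivideEdges (Gnrs n 1 (n - 3) true) F) (Sum.inl hub)
      (Sum.inr ⟨s(hub, c), hxF⟩) (Sum.inl c) pos (2 * n - 2) := by
    have hlt : ∀ i : Fin n, (Sum.inl i : Fin n ⊕ F) ≠ Sum.inl hub → i.val < n - 1 := by
      intro i hi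
      have : i.val ≠ hub.val := fun e => hi (congrArg _ (Fin.ext e))
      have := i.2
      omega
    have hadj : ∀ (i : Fin n) (e : F), (Sum.inl i : Fin n ⊕ F) ≠ Sum.inl hub →
        e ≠ ⟨s(hub, c), hxF⟩ →
        (SubdivideEdges (Gnrs n 1 (n - 3) true) F).Adj (Sum.inl i) (Sum.inr e) →
        pos (Sum.inl i) = pos (Sum.inr e) + 1 ∨ pos (Sum.inr e) = pos (Sum.inl i) + 1 ∨
          (pos (Sum.inl i) = 0 ∧ pos (Sum.inr e) + 1 = 2 * n - 2) := by
      intro i e hi he ha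
      obtain ⟨a, b, hab, hb, h⟩ := hr e he
      rw [sub_adj_lr, hab, Sym2.mem_iff] at ha
      rw [hl]
      rcases ha with rfl | rfl <;> omega
    constructor
    · rintro (i | e) h1 h2
      · rw [hl]; have := hlt i h1; omega
      · obtain ⟨a, b, hab, hb, h⟩ := hr e (fun h => h2 (congrArg _ h))
        omega
    · rintro (i | e) (j | e') h1 h2 h3 h4 hp
      · rw [hl, hl] at hp
        exact congrArg _ (Fin.ext (by omega))
      · obtain ⟨a, b, hab, hb, h⟩ := hr e' (fun h => h4 (congrArg _ h))
        rw [hl] at hp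
        omega
      · obtain ⟨a, b, hab, hb, h⟩ := hr e (fun h => h2 (congrArg _ h))
        rw [hl] at hp
        omega
      · obtain ⟨a, b, hab, hb, h⟩ := hr e (fun h => h2 (congrArg _ h))
        obtain ⟨a', b', hab', hb', h'⟩ := hr e' (fun h => h4 (congrArg _ h))
        congr 1
        apply Subtype.ext
        rw [hab, hab', show a = a' from Fin.ext (by omega), show b = b' from Fin.ext (by omega)]
    · rintro (i | e) (j | e') h1 h2 h3 h4 ha
      · exfalso
        rw [sub_adj_ll] at ha
        refine ha.2 (Or.inl ⟨ha.1, ?_⟩)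
        rw [Sym2.mem_iff]
        rintro (h | h)
        · exact h1 (congrArg _ h.symm)
        · exact h3 (congrArg _ h.symm)
      · have := hadj i e' h1 (fun h => h4 (congrArg _ h)) ha
        omega
      · have := hadj j e h3 (fun h => h2 (congrArg _ h)) ha.symm
        omega
      · exact absurd ha (sub_adj_rr _ _)
    · rintro (i | e) h1 ha
      · have := (sub_adj_lr _ _).1 ha.symm
        rcases Sym2.mem_iff.1 this with h | h
        · exact absurd (congrArg _ h) h1
        · exact congrArg _ h
      · exact absurd ha (sub_adj_rr _ _)
    · show epos s(hub, c) = 2 * c.val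
      simp [epos]
    · intro h
      have := congrArg Fin.val (Sum.inl_injective h)
      omega
    · simp
  exact W.minorFree

/-- Theorem 20(i): for `n ≥ 6`, the wheel `Wₙ = G⁺_{n,1,n-3}`
(with hub `vₙ`) has exactly `n - 1` maximal subdividable sets of edges, namely the
sets consisting of all rim edges (the edges avoiding the hub) together with exactly
one spoke (an edge at the hub). -/
theorem wheel_maxSubdividable (n : ℕ) (hn : 6 ≤ n) :
    (∀ F : Set (Sym2 (Fin n)),
      MaxSubdividable (Gnrs n 1 (n - 3) true) F ↔
        ∃ e ∈ (Gnrs n 1 (n - 3) true).edgeSet,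
          (⟨n - 1, by omega⟩ : Fin n) ∈ e ∧
          F = {e' ∈ (Gnrs n 1 (n - 3) true).edgeSet |
                 (⟨n - 1, by omega⟩ : Fin n) ∉ e'} ∪ {e}) ∧
    {F | MaxSubdividable (Gnrs n 1 (n - 3) true) F}.ncard = n - 1 := by
  set hub : Fin n := ⟨n - 1, by omega⟩ with hhub
  have hv : hub.val = n - 1 := rfl
  have hspoke : ∀ v : Fin n, v ≠ hub → s(v, hub) ∈ (Gnrs n 1 (n - 3) true).edgeSet := by
    intro v hne
    rw [SimpleGraph.mem_edgeSet, wheel_adj hn]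
    exact ⟨fun e => hne (Fin.ext e), Or.inr (Or.inl hv)⟩
  have char : ∀ F : Set (Sym2 (Fin n)),
      MaxSubdividable (Gnrs n 1 (n - 3) true) F ↔
        ∃ e ∈ (Gnrs n 1 (n - 3) true).edgeSet, hub ∈ e ∧
          F = {e' ∈ (Gnrs n 1 (n - 3) true).edgeSet | hub ∉ e'} ∪ {e} := by
    intro F
    constructor
    · rintro ⟨hF, hmax⟩
      obtain ⟨e, he, hhe, hsub⟩ : ∃ e ∈ (Gnrs n 1 (n - 3) true).edgeSet, hub ∈ e ∧
          F ⊆ {e' ∈ (Gnrs n 1 (n - 3) true).edgeSet | hub ∉ e'} ∪ {e} := by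
        by_cases h : ∃ e ∈ F, hub ∈ e
        · obtain ⟨e, he, hhe⟩ := h
          refine ⟨e, hF.1 he, hhe, fun e' he' => ?_⟩
          by_cases h' : hub ∈ e'
          · exact Or.inr (spoke_unique n hn F hub hv hF e' e he' he h' hhe)
          · exact Or.inl ⟨hF.1 he', h'⟩
        · push Not at h
          refine ⟨s(⟨0, by omega⟩, hub), hspoke _ ?_, by simp, fun e' he' =>
            Or.inl ⟨hF.1 he', h e' he'⟩⟩
          intro e
          have := congrArg Fin.val e
          simp only [hv] at this
          omega
      exact ⟨e, he, hhe, (hmax _ (rim_spoke_subdividable n hn hub hv e he hhe) hsub).symm⟩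
    · rintro ⟨e, he, hhe, rfl⟩
      refine ⟨rim_spoke_subdividable n hn hub hv e he hhe, fun F' hF' hsub => ?_⟩
      refine Set.Subset.antisymm (fun e' he' => ?_) hsub
      by_cases h' : hub ∈ e'
      · exact Or.inr (spoke_unique n hn F' hub hv hF' e' e he' (hsub (Or.inr rfl)) h' hhe)
      · exact Or.inl ⟨hF'.1 he', h'⟩
  refine ⟨char, ?_⟩
  have himg : {F | MaxSubdividable (Gnrs n 1 (n - 3) true) F} =
      (fun v : Fin n => {e' ∈ (Gnrs n 1 (n - 3) true).edgeSet | hub ∉ e'} ∪ {s(v, hub)}) ''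
        {hub}ᶜ := by
    ext F
    rw [Set.mem_ofPred_eq, char]
    constructor
    · rintro ⟨e, he, ⟨v, rfl⟩, rfl⟩
      refine ⟨v, fun h => ?_, ?_⟩
      · exact ((SimpleGraph.mem_edgeSet _).1 he).ne (Set.mem_singleton_iff.1 h).symm
      · simp only [Sym2.eq_swap (a := v)]
    · rintro ⟨v, hne, rfl⟩
      exact ⟨s(v, hub), hspoke v hne, by simp, rfl⟩
  rw [himg, Set.ncard_image_of_injective, Set.ncard_compl, Set.ncard_singleton,
    Nat.card_eq_fintype_card, Fintype.card_fin]
  intro v w hvw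
  have h1 : s(v, hub) ∈ {e' ∈ (Gnrs n 1 (n - 3) true).edgeSet | hub ∉ e'} ∪ {s(w, hub)} := by
    refine (Set.ext_iff.1 hvw _).1 (Or.inr rfl)
  rcases h1 with h | h
  · exact absurd h.2 (by simp)
  · exact (Sym2.congr_left).1 h

end K24Paper
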